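/- Consider n units in the spillover setting: for each unit i, Y_i := f_i(D_i, D_{−i}, η_i) ∈ {0, 1} with f_i measurable, and additionally each unit has a remotely sensed variable R_i : Ω → ℛ. Suppose for each i: (Randomization) under P(·|S_i = e), D_i is independent of η_i; (Positivity) P(S_i = e, D_i = d, Y_i = y) > 0 and P(S_i = o, Y_i = y) > 0 for all d, y ∈ {0, 1}; (Stability) R_i is conditionally independent of S_i given (D_i, Y_i); (No direct effect) R_i is conditionally independent of D_i given Y_i. Define Δᵉ_i := 1{D_i = 1, S_i = e}/P(D_i = 1, S_i = e) − 1{D_i = 0, S_i = e}/P(D_i = 0, S_i = e), Δᵒ_i := 1{Y_i = 1, S_i = o}/P(Y_i = 1, S_i = o) − 1{Y_i = 0, S_i = o}/P(Y_i = 0, S_i = o), and θ_i := E[Y_i^{dir}(1) − Y_i^{dir}(0) | S_i = e], where Y_i^{dir}(d) := G_{i,d}(η_i) with G_{i,d} ∘ η_i a version of the conditional expectation of f_i(d, D_{−i}, η_i) given σ(η_i) under P(·|D_i = d, S_i = e). Then for each i, P-almost surely E[Δᵉ_i | σ(R_i)] = θ_i · E[Δᵒ_i | σ(R_i)]; in particular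 the average direct treatment effect θ_n := (1/n) Σ_{i=1}^n θ_i satisfies θ_n = (1/n) Σ_{i=1}^n E[Δᵉ_i | σ(R_i)] / E[Δᵒ_i | σ(R_i)] almost surely on the event where each E[Δᵒ_i | σ(R_i)] ≠ 0. -/

import Mathlib

open MeasureTheory ProbabilityTheory

noncomputable section

/-- Sample indicator values: experimental (`e`) or observational (`o`). -/
inductive Sample : Type
  | e
  | o
deriving DecidableEq

instance : MeasurableSpace Sample := ⊤

/-- Real-valued indicator of a boolean (`{0,1}`-valued variable). -/
def b2r (b : Bool) : ℝ := if b then 1 else 0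

/-- `CondIndepOf P R V W` : the conditional law of `R` given `V = v, W = w` agrees with
the conditional law of `R` given `V = v`, for all values with positive probability;
this is the notion of "R is conditionally independent of W given V" for variables with
countable ranges. -/
def CondIndepOf {Ω 𝓡 V W : Type*} [MeasurableSpace Ω] [MeasurableSpace 𝓡]
    (P : Measure Ω) (R : Ω → 𝓡) (Vf : Ω → V) (Wf : Ω → W) : Prop :=
  ∀ v w, 0 < P {ω | Vf ω = v ∧ Wf ω = w} →
    (P[|{ω | Vf ω = v ∧ Wf ω = w}]).map R = (P[|{ω | Vf ω = v}]).map R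

lemma measureReal_cond_apply {Ω : Type*} [MeasurableSpace Ω] {P : Measure Ω} {C : Set Ω}
    (hC : MeasurableSet C) (T : Set Ω) :
    (P[|C]).real T = (P.real C)⁻¹ * P.real (C ∩ T) := by
  simp [measureReal_def, cond_apply hC]

section Identification

variable {Ω 𝓡 E : Type*} [MeasurableSpace Ω] [MeasurableSpace 𝓡] [MeasurableSpace E]
  {P : Measure Ω} [IsProbabilityMeasure P]

/-- Under stability and no direct effect, the probability that `R` lands in `A` on a cell of
`(D, Y, S)` factors through the conditional law of `R` given `Y`. -/
lemma measureReal_cell_inter_preimage {D Y : Ω → Bool} {S : Ω → Sample} {R : Ω → 𝓡}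
    (hS : Measurable S) (hD : Measurable D) (hY : Measurable Y) (hR : Measurable R)
    (stab : CondIndepOf P R (fun ω => (D ω, Y ω)) S) (nde : CondIndepOf P R Y D)
    {A : Set 𝓡} (hA : MeasurableSet A) (d y : Bool) (s : Sample) :
    P.real ({ω | D ω = d ∧ Y ω = y ∧ S ω = s} ∩ R ⁻¹' A) =
      P.real {ω | D ω = d ∧ Y ω = y ∧ S ω = s} * (P[|{ω | Y ω = y}]).real (R ⁻¹' A) := by
  rcases eq_or_ne (P {ω | D ω = d ∧ Y ω = y ∧ S ω = s}) 0 with h0 | h0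
  · simp [measureReal_def, h0, measure_inter_null_of_null_left]
  have mS : MeasurableSet {ω | S ω = s} := hS (show MeasurableSet {s} from trivial)
  have mD : MeasurableSet {ω | D ω = d} := hD (measurableSet_singleton d)
  have mY : MeasurableSet {ω | Y ω = y} := hY (measurableSet_singleton y)
  have e1 : {ω | (D ω, Y ω) = (d, y) ∧ S ω = s} = {ω | D ω = d ∧ Y ω = y ∧ S ω = s} := by
    ext ω; simp [and_assoc]
  have e2 : {ω | (D ω, Y ω) = (d, y)} = {ω | Y ω = y ∧ D ω = d} := by
    ext ω; simp [and_comm]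
  have h1 := stab (d, y) s (by rw [e1]; exact pos_iff_ne_zero.2 h0)
  have h2 := nde y d ((pos_iff_ne_zero.2 h0).trans_le
    (measure_mono fun ω h => ⟨h.2.1, h.1⟩))
  rw [e1, e2, h2] at h1
  have h3 := congrArg (fun μ => μ A) h1
  simp only [Measure.map_apply hR hA] at h3
  rw [measureReal_def (μ := P[|{ω | Y ω = y}]), ← h3, ← measureReal_def,
    measureReal_cond_apply (C := {ω | D ω = d ∧ Y ω = y ∧ S ω = s}) (mD.inter (mY.inter mS)),
    mul_inv_cancel_left₀]
  exact (measureReal_ne_zero_iff).2 h0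

/-- The integral over `T` of the difference of the normalized indicators of two cells. -/
lemma setIntegral_normalized_indicator_sub {X : Ω → Bool} {S : Ω → Sample}
    (hS : Measurable S) (hX : Measurable X) (s : Sample) (a b : ℝ)
    (T : Set Ω) {Δ : Ω → ℝ}
    [∀ x ω, Decidable (X ω = x ∧ S ω = s)]
    (hΔ : ∀ ω, Δ ω = (if X ω = true ∧ S ω = s then (1 : ℝ) else 0) / a -
      (if X ω = false ∧ S ω = s then (1 : ℝ) else 0) / b) :
    Integrable Δ P ∧ ∫ ω in T, Δ ω ∂P =
      P.real ({ω | X ω = true ∧ S ω = s} ∩ T) / a -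
        P.real ({ω | X ω = false ∧ S ω = s} ∩ T) / b := by
  have m : ∀ x, MeasurableSet {ω | X ω = x ∧ S ω = s} := fun x =>
    (hX (measurableSet_singleton x)).inter (hS (show MeasurableSet {s} from trivial))
  have hΔ' : Δ = fun ω => {ω | X ω = true ∧ S ω = s}.indicator 1 ω / a -
      {ω | X ω = false ∧ S ω = s}.indicator 1 ω / b := by
    funext ω
    rw [hΔ]
    simp [Set.indicator_apply]
  have hi : ∀ (c : ℝ) (x : Bool) (Q : Measure Ω) [IsFiniteMeasure Q],
      Integrable (fun ω => {ω | X ω = x ∧ S ω = s}.indicator (1 : Ω → ℝ) ω / c) Q :=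
    fun c x Q _ => ((integrable_const (1 : ℝ)).indicator (m x)).div_const c
  subst hΔ'
  refine ⟨(hi a true P).sub (hi b false P), ?_⟩
  rw [integral_sub (hi _ _ _) (hi _ _ _), integral_div, integral_div,
    integral_indicator_one (m _), integral_indicator_one (m _),
    measureReal_restrict_apply (m _), measureReal_restrict_apply (m _)]

/-- Splitting a set along a Boolean variable `V`. -/
lemma measureReal_cell_split {V : Ω → Bool} (hV : Measurable V) (C : Set Ω) :
    P.real C = P.real ({ω | V ω = true} ∩ C) + P.real ({ω | V ω = false} ∩ C) := by
  have m : MeasurableSet {ω | V ω = true} := hV (measurableSet_singleton true)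
  rw [← measureReal_inter_add_sdiff (s := C) m, Set.inter_comm]
  congr 2
  ext ω
  simp [and_comm]

/-- If `D` is independent of `η` given `S = e`, the mean of `G ∘ η` given `S = e`, where `G ∘ η`
is a version of the conditional expectation of a `Bool`-valued variable `F` given `η` on the cell
`D = d, S = e`, is the probability of `F` on that cell. -/
lemma integral_direct_outcome {D F : Ω → Bool} {C : Set Ω} {η : Ω → E} {G : E → ℝ} {d : Bool}
    (hD : Measurable D) (hF : Measurable F) (hC : MeasurableSet C) (hη : Measurable η)
    (hG : Measurable G) (hind : IndepFun D η (P[|C]))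
    (hpos : P ({ω | D ω = d} ∩ C) ≠ 0)
    (hce : (fun ω => G (η ω)) =ᵐ[P[|{ω | D ω = d} ∩ C]]
      (P[|{ω | D ω = d} ∩ C])[fun ω => b2r (F ω) | MeasurableSpace.comap η inferInstance]) :
    Integrable (fun ω => G (η ω)) (P[|C]) ∧
      ∫ ω, G (η ω) ∂(P[|C]) =
        P.real ({ω | D ω = d} ∩ {ω | F ω = true} ∩ C) / P.real ({ω | D ω = d} ∩ C) := by
  have mD : MeasurableSet {ω | D ω = d} := hD (measurableSet_singleton d)
  have mF : MeasurableSet {ω | F ω = true} := hF (measurableSet_singleton true)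
  have hC0 : P C ≠ 0 := fun h => hpos (measure_inter_null_of_null_right _ h)
  have : IsProbabilityMeasure (P[|C]) := cond_isProbabilityMeasure hC0
  have : IsProbabilityMeasure (P[|{ω | D ω = d} ∩ C]) := cond_isProbabilityMeasure hpos
  have hD0 : (P[|C]) {ω | D ω = d} ≠ 0 := by
    rw [cond_apply hC, Set.inter_comm]
    exact mul_ne_zero (ENNReal.inv_ne_zero.2 (measure_ne_top _ _)) hpos
  have hmap : (P[|{ω | D ω = d} ∩ C]).map η = (P[|C]).map η := by
    ext B hB
    have hD0' : (P[|C]) (D ⁻¹' {d}) ≠ 0 := hD0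
    rw [Set.inter_comm, ← cond_cond_eq_cond_inter hC mD,
      Measure.map_apply hη hB, Measure.map_apply hη hB, cond_apply mD,
      show {ω | D ω = d} = D ⁻¹' {d} from rfl,
      hind.measure_inter_preimage_eq_mul _ _ (measurableSet_singleton d) hB, ← mul_assoc,
      ENNReal.inv_mul_cancel hD0' (measure_ne_top _ _), one_mul]
  have hint : Integrable (fun ω => G (η ω)) (P[|{ω | D ω = d} ∩ C]) :=
    integrable_condExp.congr hce.symm
  constructor
  · have h := (integrable_map_measure hG.aestronglyMeasurable hη.aemeasurable).2 hint
    rw [hmap] at h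
    exact (integrable_map_measure hG.aestronglyMeasurable hη.aemeasurable).1 h
  · rw [← integral_map hη.aemeasurable hG.aestronglyMeasurable, ← hmap,
      integral_map hη.aemeasurable hG.aestronglyMeasurable, integral_congr_ae hce,
      integral_condExp hη.comap_le]
    have hb : (fun ω => b2r (F ω)) = {ω | F ω = true}.indicator 1 := by
      funext ω
      simp [b2r, Set.indicator_apply]
    rw [hb, integral_indicator_one mF, measureReal_cond_apply (mD.inter hC), div_eq_inv_mul]
    congr 2
    ext ω
    simp only [Set.mem_inter_iff]
    tauto

/-- If `∫_T Δe = θ ∫_T Δo` for all `T ∈ σ(R)`, the conditional expectations are proportional. -/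
lemma condExp_ae_eq_const_mul_condExp {R : Ω → 𝓡} (hR : Measurable R) {Δe Δo : Ω → ℝ} {θ : ℝ}
    (he : Integrable Δe P) (ho : Integrable Δo P)
    (h : ∀ A, MeasurableSet A → ∫ ω in R ⁻¹' A, Δe ω ∂P = θ * ∫ ω in R ⁻¹' A, Δo ω ∂P) :
    P[Δe | MeasurableSpace.comap R inferInstance] =ᵐ[P]
      fun ω => θ * (P[Δo | MeasurableSpace.comap R inferInstance]) ω := by
  refine (ae_eq_condExp_of_forall_setIntegral_eq hR.comap_le he
    (fun _ _ _ => (integrable_condExp.const_mul θ).integrableOn) ?_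
    (stronglyMeasurable_condExp.const_mul θ).aestronglyMeasurable).symm
  rintro T hT -
  obtain ⟨A, hA, rfl⟩ := hT
  rw [integral_const_mul, setIntegral_condExp hR.comap_le ho ⟨A, hA, rfl⟩, h A hA]

/-- The remotely sensed contrasts over `R ⁻¹' A` in the two samples are proportional, with factor
the difference of the conditional outcome probabilities in the experimental sample. -/
lemma contrast_eq_mul_contrast {D Y : Ω → Bool} {S : Ω → Sample} {R : Ω → 𝓡}
    (hS : Measurable S) (hD : Measurable D) (hY : Measurable Y) (hR : Measurable R)
    (stab : CondIndepOf P R (fun ω => (D ω, Y ω)) S) (nde : CondIndepOf P R Y D)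
    {s t : Sample} (hs : ∀ d, P {ω | D ω = d ∧ S ω = s} ≠ 0)
    (ht : ∀ y, P {ω | Y ω = y ∧ S ω = t} ≠ 0)
    {A : Set 𝓡} (hA : MeasurableSet A) :
    P.real ({ω | D ω = true ∧ S ω = s} ∩ R ⁻¹' A) / P.real {ω | D ω = true ∧ S ω = s} -
      P.real ({ω | D ω = false ∧ S ω = s} ∩ R ⁻¹' A) / P.real {ω | D ω = false ∧ S ω = s} =
    (P.real {ω | D ω = true ∧ Y ω = true ∧ S ω = s} / P.real {ω | D ω = true ∧ S ω = s} -
      P.real {ω | D ω = false ∧ Y ω = true ∧ S ω = s} / P.real {ω | D ω = false ∧ S ω = s}) *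
    (P.real ({ω | Y ω = true ∧ S ω = t} ∩ R ⁻¹' A) / P.real {ω | Y ω = true ∧ S ω = t} -
      P.real ({ω | Y ω = false ∧ S ω = t} ∩ R ⁻¹' A) / P.real {ω | Y ω = false ∧ S ω = t}) := by
  have cell := fun d y s => measureReal_cell_inter_preimage hS hD hY hR stab nde hA d y s
  have splitD : ∀ (d : Bool) (T : Set Ω), P.real ({ω | D ω = d ∧ S ω = s} ∩ T) =
      P.real ({ω | D ω = d ∧ Y ω = true ∧ S ω = s} ∩ T) +
        P.real ({ω | D ω = d ∧ Y ω = false ∧ S ω = s} ∩ T) := by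
    intro d T
    rw [measureReal_cell_split hY]
    congr 2 <;> (ext ω; simp only [Set.mem_inter_iff, Set.mem_ofPred_eq]; tauto)
  have splitY : ∀ (y : Bool) (T : Set Ω), P.real ({ω | Y ω = y ∧ S ω = t} ∩ T) =
      P.real ({ω | D ω = true ∧ Y ω = y ∧ S ω = t} ∩ T) +
        P.real ({ω | D ω = false ∧ Y ω = y ∧ S ω = t} ∩ T) := by
    intro y T
    rw [measureReal_cell_split hD]
    congr 2 <;> (ext ω; simp only [Set.mem_inter_iff, Set.mem_ofPred_eq]; tauto)
  have hyt : ∀ y, P.real ({ω | Y ω = y ∧ S ω = t} ∩ R ⁻¹' A) / P.real {ω | Y ω = y ∧ S ω = t} =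
      (P[|{ω | Y ω = y}]).real (R ⁻¹' A) := by
    intro y
    have h := splitY y Set.univ
    simp only [Set.inter_univ] at h
    rw [div_eq_iff ((measureReal_ne_zero_iff).2 (ht y)), splitY, cell, cell, h]
    ring
  have hds : ∀ d, P.real ({ω | D ω = d ∧ S ω = s} ∩ R ⁻¹' A) / P.real {ω | D ω = d ∧ S ω = s} =
      P.real {ω | D ω = d ∧ Y ω = true ∧ S ω = s} / P.real {ω | D ω = d ∧ S ω = s} *
        ((P[|{ω | Y ω = true}]).real (R ⁻¹' A) - (P[|{ω | Y ω = false}]).real (R ⁻¹' A)) +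
      (P[|{ω | Y ω = false}]).real (R ⁻¹' A) := by
    intro d
    have h := splitD d Set.univ
    simp only [Set.inter_univ] at h
    have h0 : P.real {ω | D ω = d ∧ S ω = s} ≠ 0 := (measureReal_ne_zero_iff).2 (hs d)
    rw [splitD, cell, cell]
    field_simp
    rw [h]
    ring
  rw [hds, hds, hyt, hyt]
  ring

end Identification

/-- **Theorem (Identification with spillovers).** For each unit `i`,
`E[Δᵉ_i | σ(R_i)] = θ_i · E[Δᵒ_i | σ(R_i)]` `P`-a.s.; consequently the average direct
treatment effect `θ_n` equals the average of the ratios on the event where each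
denominator is nonzero. -/
theorem statement16
    {Ω 𝓡 : Type*} [MeasurableSpace Ω] [MeasurableSpace 𝓡] [StandardBorelSpace 𝓡]
    (P : Measure Ω) [IsProbabilityMeasure P]
    (n : ℕ) (hn : 0 < n)
    {E : Fin n → Type*} [∀ i, MeasurableSpace (E i)]
    (S : Fin n → Ω → Sample) (D : Fin n → Ω → Bool)
    (Dm : Fin n → Ω → (Fin (n - 1) → Bool))
    (η : (i : Fin n) → Ω → E i)
    (R : Fin n → Ω → 𝓡)
    (f : (i : Fin n) → Bool → (Fin (n - 1) → Bool) → E i → Bool)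
    (hS : ∀ i, Measurable (S i)) (hD : ∀ i, Measurable (D i))
    (hDm : ∀ i, Measurable (Dm i)) (hη : ∀ i, Measurable (η i))
    (hR : ∀ i, Measurable (R i))
    (hf : ∀ i, Measurable fun q : Bool × (Fin (n - 1) → Bool) × E i =>
      f i q.1 q.2.1 q.2.2)
    (Y : Fin n → Ω → Bool)
    (hYdef : ∀ i ω, Y i ω = f i (D i ω) (Dm i ω) (η i ω))
    -- Randomization: D_i ⫫ η_i under P(·|S_i = e)
    (randomization : ∀ i, IndepFun (D i) (η i) (P[|{ω | S i ω = Sample.e}]))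
    -- Positivity
    (positivity_e : ∀ (i : Fin n) (d y : Bool),
      0 < P {ω | S i ω = Sample.e ∧ D i ω = d ∧ Y i ω = y})
    (positivity_o : ∀ (i : Fin n) (y : Bool),
      0 < P {ω | S i ω = Sample.o ∧ Y i ω = y})
    -- Stability: R_i ⫫ S_i | (D_i, Y_i)
    (stability : ∀ i, CondIndepOf P (R i) (fun ω => (D i ω, Y i ω)) (S i))
    -- No direct effect: R_i ⫫ D_i | Y_i
    (noDirectEffect : ∀ i, CondIndepOf P (R i) (Y i) (D i))
    -- Δᵉ_i and Δᵒ_i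
    (Δe Δo : Fin n → Ω → ℝ)
    (hΔe : ∀ i ω, Δe i ω =
      (if D i ω = true ∧ S i ω = Sample.e then (1 : ℝ) else 0) /
        (P {ω' | D i ω' = true ∧ S i ω' = Sample.e}).toReal -
      (if D i ω = false ∧ S i ω = Sample.e then (1 : ℝ) else 0) /
        (P {ω' | D i ω' = false ∧ S i ω' = Sample.e}).toReal)
    (hΔo : ∀ i ω, Δo i ω =
      (if Y i ω = true ∧ S i ω = Sample.o then (1 : ℝ) else 0) /
        (P {ω' | Y i ω' = true ∧ S i ω' = Sample.o}).toReal -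
      (if Y i ω = false ∧ S i ω = Sample.o then (1 : ℝ) else 0) /
        (P {ω' | Y i ω' = false ∧ S i ω' = Sample.o}).toReal)
    -- G_{i,d} ∘ η_i is a version of E[f_i(d, D_{−i}, η_i) | σ(η_i)] under
    -- P(·|D_i = d, S_i = e); Y_i^{dir}(d) := G_{i,d}(η_i)
    (G : (i : Fin n) → Bool → E i → ℝ)
    (hGmeas : ∀ i d, Measurable (G i d))
    (hGce : ∀ (i : Fin n) (d : Bool),
      (fun ω => G i d (η i ω))
        =ᵐ[P[|{ω | D i ω = d ∧ S i ω = Sample.e}]]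
          (P[|{ω | D i ω = d ∧ S i ω = Sample.e}])[(fun ω =>
              b2r (f i d (Dm i ω) (η i ω))) |
            MeasurableSpace.comap (η i) inferInstance])
    -- θ_i := E[Y_i^{dir}(1) − Y_i^{dir}(0) | S_i = e]
    (θ : Fin n → ℝ)
    (hθ : ∀ i, θ i = ∫ ω, (G i true (η i ω) - G i false (η i ω))
      ∂(P[|{ω | S i ω = Sample.e}]))
    -- θ_n := (1/n) Σ_i θ_i
    (θn : ℝ) (hθn : θn = (1 / (n : ℝ)) * ∑ i : Fin n, θ i) :
    (∀ i : Fin n,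
      P[(Δe i) | MeasurableSpace.comap (R i) inferInstance]
        =ᵐ[P] fun ω =>
          θ i * (P[(Δo i) | MeasurableSpace.comap (R i) inferInstance]) ω) ∧
    (∀ᵐ ω ∂P,
      (∀ i : Fin n,
        (P[(Δo i) | MeasurableSpace.comap (R i) inferInstance]) ω ≠ 0) →
      θn = (1 / (n : ℝ)) * ∑ i : Fin n,
        (P[(Δe i) | MeasurableSpace.comap (R i) inferInstance]) ω /
          (P[(Δo i) | MeasurableSpace.comap (R i) inferInstance]) ω) := by
  have hY : ∀ i, Measurable (Y i) := by
    intro i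
    rw [show Y i = fun ω => f i (D i ω) (Dm i ω) (η i ω) from funext (hYdef i)]
    exact (hf i).comp ((hD i).prodMk ((hDm i).prodMk (hη i)))
  have key : ∀ i : Fin n,
      P[(Δe i) | MeasurableSpace.comap (R i) inferInstance]
        =ᵐ[P] fun ω =>
          θ i * (P[(Δo i) | MeasurableSpace.comap (R i) inferInstance]) ω := by
    intro i
    have mS : MeasurableSet {ω | S i ω = Sample.e} := hS i (show MeasurableSet {Sample.e} from trivial)
    have pe : ∀ d, P {ω | D i ω = d ∧ S i ω = Sample.e} ≠ 0 := fun d =>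
      ((positivity_e i d true).trans_le (measure_mono fun ω h => And.intro h.2.1 h.1)).ne'
    have po : ∀ y, P {ω | Y i ω = y ∧ S i ω = Sample.o} ≠ 0 := fun y =>
      ((positivity_o i y).trans_le (measure_mono fun ω h => And.intro h.2 h.1)).ne'
    have mean : ∀ d, Integrable (fun ω => G i d (η i ω)) (P[|{ω | S i ω = Sample.e}]) ∧
        ∫ ω, G i d (η i ω) ∂(P[|{ω | S i ω = Sample.e}]) =
          P.real {ω | D i ω = d ∧ Y i ω = true ∧ S i ω = Sample.e} /
            P.real {ω | D i ω = d ∧ S i ω = Sample.e} := by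
      intro d
      have hF : Measurable fun ω => f i d (Dm i ω) (η i ω) :=
        (hf i).comp (measurable_const.prodMk ((hDm i).prodMk (hη i)))
      have h := integral_direct_outcome (hD i) hF mS (hη i) (hGmeas i d) (randomization i)
        (pe d) (hGce i d)
      refine ⟨h.1, h.2.trans ?_⟩
      congr 2
      ext ω
      simp only [Set.mem_inter_iff, Set.mem_ofPred_eq, hYdef]
      constructor
      · rintro ⟨⟨rfl, h1⟩, h2⟩
        exact ⟨rfl, h1, h2⟩
      · rintro ⟨rfl, h1, h2⟩
        exact ⟨⟨rfl, h1⟩, h2⟩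
    have hθi : θ i = _ := (hθ i).trans (integral_sub (mean true).1 (mean false).1)
    rw [(mean true).2, (mean false).2] at hθi
    have he := fun T => setIntegral_normalized_indicator_sub (P := P) (hS i) (hD i)
      Sample.e _ _ T (hΔe i)
    have ho := fun T => setIntegral_normalized_indicator_sub (P := P) (hS i) (hY i)
      Sample.o _ _ T (hΔo i)
    refine condExp_ae_eq_const_mul_condExp (hR i) (he .univ).1 (ho .univ).1 fun A hA => ?_
    rw [(he _).2, (ho _).2, hθi]
    exact contrast_eq_mul_contrast (hS i) (hD i) (hY i) (hR i) (stability i) (noDirectEffect i)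
      pe po hA
  refine ⟨key, ?_⟩
  filter_upwards [ae_all_iff.2 key] with ω hω hne
  rw [hθn]
  congr 1
  refine Finset.sum_congr rfl fun i _ => ?_
  rw [hω i, mul_div_cancel_right₀ _ (hne i)]
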